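/- arXiv:2006.12440 — 2 statements merged into one kernel-verified Lean document; each statement's English description precedes it below -/
import Mathlib

section
/- Let P ∈ 𝒫ₙ \ {I^{⊗n}} and let Û be the channel representation of R(P). Then every diagonal entry Û_{rr} (for P_r ∈ 𝒫ₙ) equals either 1 or 1/√2. -/
open Matrix Complex

/-- The four single-qubit Pauli matrices I, X, Y, Z. -/
noncomputable def pauli : Fin 4 → Matrix (Fin 2) (Fin 2) ℂ :=
  ![1, !![0, 1; 1, 0], !![0, -Complex.I; Complex.I, 0], !![1, 0; 0, -1]]

/-- The n-qubit Pauli matrix A₁ ⊗ ⋯ ⊗ Aₙ (Kronecker product realized entrywise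
on the index type `Fin n → Fin 2`). -/
noncomputable def nPauli {n : ℕ} (A : Fin n → Fin 4) :
    Matrix (Fin n → Fin 2) (Fin n → Fin 2) ℂ :=
  fun x y => ∏ j, pauli (A j) (x j) (y j)

/-- R(P) = ½(1+e^{iπ/4})·I + ½(1−e^{iπ/4})·P. -/
noncomputable def RP {n : ℕ} (A : Fin n → Fin 4) :
    Matrix (Fin n → Fin 2) (Fin n → Fin 2) ℂ :=
  ((1 + Complex.exp (Complex.I * Real.pi / 4)) / 2) • 1 +
    ((1 - Complex.exp (Complex.I * Real.pi / 4)) / 2) • nPauli A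

/-- The channel representation: Û_{rs} = (1/2ⁿ)·Tr(P_r U P_s U†). -/
noncomputable def chanRep {n : ℕ} (U : Matrix (Fin n → Fin 2) (Fin n → Fin 2) ℂ) :
    Matrix (Fin n → Fin 4) (Fin n → Fin 4) ℂ :=
  fun r s => (1 / 2 ^ n : ℂ) * (nPauli r * U * nPauli s * Uᴴ).trace

theorem pauli_mul_self (a : Fin 4) : pauli a * pauli a = 1 := by
  fin_cases a <;> ext i j <;> fin_cases i <;> fin_cases j <;>
    simp [pauli, Matrix.mul_apply, Fin.sum_univ_two]

theorem pauli_isHermitian (a : Fin 4) : (pauli a).IsHermitian := by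
  fin_cases a <;> ext i j <;> fin_cases i <;> fin_cases j <;>
    simp [pauli, Matrix.conjTranspose_apply]

theorem pauli_commute_or_anticommute (a b : Fin 4) :
    ∃ ε : ℂ, (ε = 1 ∨ ε = -1) ∧ pauli a * pauli b = ε • (pauli b * pauli a) := by
  by_cases h : a = 0 ∨ b = 0 ∨ a = b
  · refine ⟨1, Or.inl rfl, ?_⟩
    rcases h with rfl | rfl | rfl <;> simp [pauli]
  · refine ⟨-1, Or.inr rfl, ?_⟩
    fin_cases a <;> fin_cases b <;> first
      | (exfalso; revert h; decide)
      | (ext i j; fin_cases i <;> fin_cases j <;>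
          simp [pauli, Matrix.mul_apply, Fin.sum_univ_two])

theorem nPauli_mul_apply {n : ℕ} (A B : Fin n → Fin 4) (x y : Fin n → Fin 2) :
    (nPauli A * nPauli B) x y = ∏ j, (pauli (A j) * pauli (B j)) (x j) (y j) := by
  simp only [Matrix.mul_apply, nPauli, Fintype.prod_sum, Finset.prod_mul_distrib]

theorem nPauli_mul_self {n : ℕ} (A : Fin n → Fin 4) : nPauli A * nPauli A = 1 := by
  ext x y
  simp only [nPauli_mul_apply, pauli_mul_self, Matrix.one_apply, funext_iff,
    Fintype.prod_ite_zero, Finset.prod_const_one]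

theorem nPauli_isHermitian {n : ℕ} (A : Fin n → Fin 4) : (nPauli A).IsHermitian := by
  ext x y
  simp only [Matrix.conjTranspose_apply, nPauli, star_prod, (pauli_isHermitian _).apply]

theorem nPauli_commute_or_anticommute {n : ℕ} (A B : Fin n → Fin 4) :
    nPauli A * nPauli B = nPauli B * nPauli A ∨
      nPauli A * nPauli B = -(nPauli B * nPauli A) := by
  choose ε hε h using fun j => pauli_commute_or_anticommute (A j) (B j)
  have hprod : (∏ j, ε j) = 1 ∨ (∏ j, ε j) = -1 :=
    Finset.prod_induction ε (fun z => z = 1 ∨ z = -1)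
      (by rintro _ _ (rfl | rfl) (rfl | rfl) <;> simp) (Or.inl rfl) fun j _ => hε j
  have hmul : nPauli A * nPauli B = (∏ j, ε j) • (nPauli B * nPauli A) := by
    ext x y
    simp only [Matrix.smul_apply, nPauli_mul_apply, h, smul_eq_mul, Finset.prod_mul_distrib]
  rcases hprod with h1 | h1 <;> rw [h1] at hmul
  · exact Or.inl (by simpa using hmul)
  · exact Or.inr (by simpa using hmul)

theorem trace_eq_zero_of_anticommute {m : Type*} [Fintype m] [DecidableEq m]
    {P Q : Matrix m m ℂ} (hQ : Q * Q = 1) (h : Q * P = -(P * Q)) : P.trace = 0 := by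
  have h1 : (Q * P * Q).trace = P.trace := by
    rw [Matrix.trace_mul_comm, ← mul_assoc, hQ, one_mul]
  have h2 : Q * P * Q = -P := by rw [h, neg_mul, mul_assoc, hQ, mul_one]
  rw [h2, Matrix.trace_neg] at h1
  exact self_eq_neg.mp h1.symm

theorem exp_I_mul_pi_div_four :
    Complex.exp (Complex.I * Real.pi / 4) =
      (Real.sqrt 2 : ℂ)⁻¹ + (Real.sqrt 2 : ℂ)⁻¹ * Complex.I := by
  have h : Complex.I * Real.pi / 4 = ((Real.pi / 4 : ℝ) : ℂ) * Complex.I := by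
    push_cast; ring
  have hs : Real.sqrt 2 / 2 = (Real.sqrt 2)⁻¹ := by
    rw [div_eq_iff two_ne_zero, eq_inv_mul_iff_mul_eq₀ (by positivity)]
    exact Real.mul_self_sqrt zero_le_two
  rw [h, Complex.exp_mul_I, ← Complex.ofReal_cos, ← Complex.ofReal_sin, Real.cos_pi_div_four,
    Real.sin_pi_div_four, hs, Complex.ofReal_inv]

theorem inv_sqrt_two_sq : ((Real.sqrt 2 : ℂ)⁻¹) ^ 2 = 1 / 2 := by
  rw [inv_pow, ← Complex.ofReal_pow, Real.sq_sqrt zero_le_two]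
  norm_num

/-- every diagonal entry of Û equals 1 or 1/√2. -/
theorem chanRep_diag {n : ℕ} (A : Fin n → Fin 4) (hA : A ≠ 0) (r : Fin n → Fin 4) :
    chanRep (RP A) r r = 1 ∨ chanRep (RP A) r r = (Real.sqrt 2 : ℂ)⁻¹ := by
  have hs := inv_sqrt_two_sq
  have hI := Complex.I_sq
  have hP := nPauli_mul_self A
  have hQ := nPauli_mul_self r
  have hcomm := nPauli_commute_or_anticommute r A
  have hconj : star (Real.sqrt 2 : ℂ)⁻¹ = (Real.sqrt 2 : ℂ)⁻¹ := by
    simp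
  simp only [chanRep, RP, Matrix.conjTranspose_add, Matrix.conjTranspose_smul,
    Matrix.conjTranspose_one, (nPauli_isHermitian A).eq, exp_I_mul_pi_div_four, star_div₀,
    star_add, star_sub, star_mul', hconj, star_one, star_ofNat,
    show star Complex.I = -Complex.I from Complex.conj_I]
  generalize (Real.sqrt 2 : ℂ)⁻¹ = s at hs ⊢
  have htr : (1 : Matrix (Fin n → Fin 2) (Fin n → Fin 2) ℂ).trace = 2 ^ n := by
    simp [Matrix.trace_one]
  have h2 : (2 ^ n : ℂ) ≠ 0 := pow_ne_zero n two_ne_zero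
  have expand (a b c d ε : ℂ) (h : nPauli r * nPauli A = ε • (nPauli A * nPauli r)) :
      (nPauli r * (a • 1 + b • nPauli A) * nPauli r * (c • 1 + d • nPauli A)).trace =
        (a * c + ε * (b * d)) * 2 ^ n + (a * d + ε * (b * c)) * (nPauli A).trace := by
    have hrPr : nPauli r * nPauli A * nPauli r = ε • nPauli A := by
      rw [h, smul_mul_assoc, mul_assoc, hQ, mul_one]
    simp only [mul_add, add_mul, mul_smul_comm, smul_mul_assoc, mul_one, one_mul, hQ, hrPr, hP,
      Matrix.trace_add, Matrix.trace_smul, smul_eq_mul, htr]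
    ring
  rcases hcomm with h | h
  · left
    rw [expand _ _ _ _ 1 (by rw [h, one_smul]), one_div, inv_mul_eq_iff_eq_mul₀ h2]
    linear_combination (2 ^ n - (nPauli A).trace) * hs * (1 - Complex.I ^ 2) / 2 -
      (2 ^ n - (nPauli A).trace) * hI / 4
  · right
    rw [expand _ _ _ _ (-1) (by rw [h, neg_one_smul]), trace_eq_zero_of_anticommute hQ h,
      one_div, inv_mul_eq_iff_eq_mul₀ h2]
    ring
end

section
/- Let P = ⊗_{j=1}^n A_j ∈ 𝒫ₙ \ {I^{⊗n}}, let Û be the channel representation of R(P), and let P_r = ⊗_{j=1}^n B_j ∈ 𝒫ₙ. Then Û_{rr} = 1/√2 if and only if the number of indices j ∈ {1,…,n} for which A_j ≠ B_j and both A_j, B_j ∈ {X, Y, Z} (i.e., A_j and B_j are distinct non-identity Paulis, so they anticommute) is odd; otherwise Û_{rr} = 1. -/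
open Matrix Complex

/-- The Kronecker product of a family of matrices, realized entrywise on the product of the
index types. -/
def piKronecker {ι κ R : Type*} [Fintype ι] [CommSemiring R] (M : ι → Matrix κ κ R) :
    Matrix (ι → κ) (ι → κ) R :=
  fun x y => ∏ j, M j (x j) (y j)

theorem piKronecker_mul {ι κ R : Type*} [Fintype ι] [DecidableEq ι] [Fintype κ]
    [CommSemiring R] (M N : ι → Matrix κ κ R) :
    piKronecker M * piKronecker N = piKronecker fun j => M j * N j := by
  ext x y
  simp only [piKronecker, Matrix.mul_apply, ← Finset.prod_mul_distrib]
  exact (Fintype.prod_sum fun j k => M j (x j) k * N j k (y j)).symm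

theorem trace_piKronecker {ι κ R : Type*} [Fintype ι] [DecidableEq ι] [Fintype κ]
    [CommSemiring R] (M : ι → Matrix κ κ R) :
    (piKronecker M).trace = ∏ j, (M j).trace := by
  simp only [piKronecker, Matrix.trace, Matrix.diag_apply]
  exact (Fintype.prod_sum fun j k => M j k k).symm

theorem piKronecker_one {ι κ R : Type*} [Fintype ι] [DecidableEq κ] [CommSemiring R] :
    piKronecker (fun _ : ι => (1 : Matrix κ κ R)) = 1 := by
  ext x y
  simp only [piKronecker, Matrix.one_apply, Finset.prod_ite_zero, Finset.prod_const_one,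
    Finset.mem_univ, true_implies, funext_iff]

theorem piKronecker_smul {ι κ R : Type*} [Fintype ι] [CommSemiring R]
    (c : ι → R) (M : ι → Matrix κ κ R) :
    piKronecker (fun j => c j • M j) = (∏ j, c j) • piKronecker M := by
  ext x y
  simp [piKronecker, Finset.prod_mul_distrib]

theorem conjTranspose_pauli (a : Fin 4) : (pauli a)ᴴ = pauli a := by
  fin_cases a <;> ext i j <;> fin_cases i <;> fin_cases j <;> simp [pauli]

theorem trace_pauli {a : Fin 4} (ha : a ≠ 0) : (pauli a).trace = 0 := by
  fin_cases a <;> simp_all [pauli, Matrix.trace]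

theorem pauli_mul_comm (a b : Fin 4) :
    pauli b * pauli a =
      (if a ≠ b ∧ a ≠ 0 ∧ b ≠ 0 then (-1 : ℂ) else 1) • (pauli a * pauli b) := by
  fin_cases a <;> fin_cases b <;> ext i j <;> fin_cases i <;> fin_cases j <;>
    simp [pauli, Matrix.mul_apply]

theorem nPauli_eq_piKronecker {n : ℕ} (A : Fin n → Fin 4) :
    nPauli A = piKronecker fun j => pauli (A j) := rfl

theorem conjTranspose_nPauli {n : ℕ} (A : Fin n → Fin 4) : (nPauli A)ᴴ = nPauli A := by
  ext x y
  simp only [nPauli, Matrix.conjTranspose_apply, star_prod]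
  refine Finset.prod_congr rfl fun j _ => ?_
  rw [← Matrix.conjTranspose_apply, conjTranspose_pauli]

theorem trace_nPauli {n : ℕ} {A : Fin n → Fin 4} (hA : A ≠ 0) : (nPauli A).trace = 0 := by
  obtain ⟨j, hj⟩ := Function.ne_iff.mp hA
  rw [nPauli_eq_piKronecker, trace_piKronecker]
  exact Finset.prod_eq_zero (Finset.mem_univ j) (trace_pauli hj)

theorem nPauli_mul_comm {n : ℕ} (A B : Fin n → Fin 4) :
    nPauli B * nPauli A =
      ((-1 : ℂ) ^ (Finset.univ.filter fun j => A j ≠ B j ∧ A j ≠ 0 ∧ B j ≠ 0).card) •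
        (nPauli A * nPauli B) := by
  simp only [nPauli_eq_piKronecker, piKronecker_mul]
  rw [funext fun j => pauli_mul_comm (A j) (B j), piKronecker_smul, Finset.prod_ite,
    Finset.prod_const, Finset.prod_const_one, mul_one]

/-- If `Q` and `P` are involutions with `Q * P = s • (P * Q)`, `P` is traceless and Hermitian,
conjugating by a linear combination `a • 1 + b • P` has diagonal entry `|a|² + s |b|²` at `Q`. -/
theorem trace_mul_conj_of_commute_up_to {m : Type*} [Fintype m] [DecidableEq m]
    {P Q : Matrix m m ℂ} {s : ℂ} (hP : P * P = 1) (hQ : Q * Q = 1) (hPH : Pᴴ = P)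
    (htr : P.trace = 0) (hcomm : Q * P = s • (P * Q)) (a b : ℂ) :
    (Q * (a • 1 + b • P) * Q * (a • 1 + b • P)ᴴ).trace =
      (a * star a + s * (b * star b)) * Fintype.card m := by
  have hconj : Q * (a • 1 + b • P) * Q = a • 1 + (b * s) • P := by
    simp only [mul_add, add_mul, mul_smul_comm, smul_mul_assoc, mul_one, hQ, hcomm, mul_assoc,
      smul_smul]
  rw [hconj, Matrix.conjTranspose_add, Matrix.conjTranspose_smul, Matrix.conjTranspose_smul,
    hPH, Matrix.conjTranspose_one]
  simp only [mul_add, add_mul, mul_smul_comm, smul_mul_assoc, mul_one, one_mul, hP,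
    Matrix.trace_add, Matrix.trace_smul, Matrix.trace_one, htr, smul_eq_mul]
  ring

theorem star_exp_I_mul_pi_div_four :
    star (Complex.exp (Complex.I * Real.pi / 4)) = Complex.exp (-(Complex.I * Real.pi / 4)) := by
  rw [Complex.star_def, ← Complex.exp_conj]
  congr 1
  simp [neg_div, map_ofNat]

theorem exp_add_exp_neg_I_mul_pi_div_four :
    Complex.exp (Complex.I * Real.pi / 4) + Complex.exp (-(Complex.I * Real.pi / 4)) =
      (Real.sqrt 2 : ℂ) := by
  have h := Complex.two_cos ((Real.pi / 4 : ℝ) : ℂ)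
  rw [← Complex.ofReal_cos, Real.cos_pi_div_four] at h
  push_cast at h
  rw [mul_div_cancel₀ _ (two_ne_zero' ℂ)] at h
  rw [h]
  congr 2 <;> ring

theorem inv_sqrt_two_eq : ((Real.sqrt 2 : ℂ))⁻¹ = (Real.sqrt 2 : ℂ) / 2 := by
  rw [← Complex.ofReal_inv, ← Real.sqrt_div_self]
  simp

theorem chanRep_RP_self {n : ℕ} {A : Fin n → Fin 4} (hA : A ≠ 0) (B : Fin n → Fin 4) :
    chanRep (RP A) B B = (1 + (Real.sqrt 2 : ℂ)⁻¹) / 2 +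
      (-1) ^ (Finset.univ.filter fun j => A j ≠ B j ∧ A j ≠ 0 ∧ B j ≠ 0).card *
        ((1 - (Real.sqrt 2 : ℂ)⁻¹) / 2) := by
  have hmul : Complex.exp (Complex.I * Real.pi / 4) *
      Complex.exp (-(Complex.I * Real.pi / 4)) = 1 := by
    rw [← Complex.exp_add, add_neg_cancel, Complex.exp_zero]
  have hadd := exp_add_exp_neg_I_mul_pi_div_four
  rw [chanRep, RP, trace_mul_conj_of_commute_up_to (nPauli_mul_self A) (nPauli_mul_self B)
    (conjTranspose_nPauli A) (trace_nPauli hA) (nPauli_mul_comm A B)]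
  simp only [star_div₀, star_add, star_sub, star_one, star_ofNat, star_exp_I_mul_pi_div_four,
    inv_sqrt_two_eq, Fintype.card_pi, Fintype.card_fin, Finset.prod_const, Finset.card_univ]
  generalize Complex.exp (Complex.I * Real.pi / 4) = c at *
  generalize Complex.exp (-(Complex.I * Real.pi / 4)) = d at *
  rw [← hadd]
  push_cast
  have h2 : (2 : ℂ) ^ n ≠ 0 := pow_ne_zero _ two_ne_zero
  field_simp
  generalize (-1 : ℂ) ^ _ = s
  linear_combination (1 + s) * hmul

theorem inv_sqrt_two_ne_one : (Real.sqrt 2 : ℂ)⁻¹ ≠ 1 := by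
  rw [Ne, inv_eq_one, Complex.ofReal_eq_one, Real.sqrt_eq_one]
  norm_num

open scoped Classical in
/-- Û_{rr} = 1/√2 iff the number of coordinates j where A_j ≠ B_j and
both are non-identity is odd; otherwise Û_{rr} = 1. -/
theorem chanRep_diag_iff {n : ℕ} (A : Fin n → Fin 4) (hA : A ≠ 0) (B : Fin n → Fin 4) :
    (chanRep (RP A) B B = (Real.sqrt 2 : ℂ)⁻¹ ↔
        Odd (Finset.univ.filter fun j => A j ≠ B j ∧ A j ≠ 0 ∧ B j ≠ 0).card) ∧
      (¬ Odd (Finset.univ.filter fun j => A j ≠ B j ∧ A j ≠ 0 ∧ B j ≠ 0).card →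
        chanRep (RP A) B B = 1) := by
  have key := chanRep_RP_self hA B
  have hone (h : ¬ Odd (Finset.univ.filter fun j => A j ≠ B j ∧ A j ≠ 0 ∧ B j ≠ 0).card) :
      chanRep (RP A) B B = 1 := by
    rw [key, (Nat.not_odd_iff_even.mp h).neg_one_pow]
    ring
  refine ⟨⟨fun h => ?_, fun h => ?_⟩, hone⟩
  · by_contra hodd
    exact inv_sqrt_two_ne_one (h.symm.trans (hone hodd))
  · rw [key, h.neg_one_pow]
    ring
end
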